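/- arXiv:math/0110024 — 2 statements merged into one kernel-verified Lean document; each statement's English description precedes it below -/
import Mathlib

section
/- For 0 < q < 1 and Re k > 0, the q-Gaussian–Mehta integral identity holds: the Jackson-type theta sum Σ_{j=−∞}^{∞} q^{(k−j)²/4} multiplied by ∏_{j=1}^{∞} (1 − q^{j+k})/(1 − q^j) equals q^{k²/4} ∏_{j=1}^{∞} (1 − q^{j/2})(1 − q^{j+k})(1 + q^{j/2 − 1/4 + k/2})(1 + q^{j/2 − 1/4 − k/2}) / (1 − q^j). -/
open Filter Topology

noncomputable def thP (Q : ℝ) (m : ℤ) : ℝ :=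
  if m < 0 then 0 else ∏ i ∈ Finset.range m.toNat, (1 - Q ^ (i + 1))⁻¹

lemma thP_rec (Q : ℝ) (h0 : 0 < Q) (h1 : Q < 1) (m : ℤ) :
    thP Q (m - 1) = (1 - Q ^ m) * thP Q m := by
  rcases lt_trichotomy m 0 with h | h | h
  · simp [thP, h, show m - 1 < 0 by omega]
  · subst h; simp [thP]
  · obtain ⟨n, rfl⟩ : ∃ n : ℕ, m = n + 1 := ⟨(m - 1).toNat, by omega⟩
    have : (1 - Q ^ (n + 1)) ≠ 0 := by
      have := pow_lt_one₀ h0.le h1 (Nat.succ_ne_zero n)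
      simp only [Nat.succ_eq_add_one] at this
      linarith
    have e1 : ((n : ℤ) + 1 - 1) = n := by ring
    have e2 : ((n : ℤ) + 1).toNat = n + 1 := by omega
    have e3 : Q ^ ((n : ℤ) + 1) = Q ^ (n + 1) := by exact_mod_cast rfl
    rw [e1, e3]
    simp only [thP, e2, show ¬ ((n : ℤ) < 0) by omega, show ¬ ((n : ℤ) + 1 < 0) by omega, if_false,
      Int.toNat_natCast, Finset.prod_range_succ]
    field_simp

lemma finite_jtp (p z : ℝ) (hp0 : 0 < p) (hp1 : p < 1) (hz : 0 < z) (n : ℕ) :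
    HasSum (fun j : ℤ => thP (p ^ 2) (n + j) * thP (p ^ 2) (n - j) * (p ^ (j * j) * z ^ j))
      (thP (p ^ 2) (2 * n) *
        ∏ m ∈ Finset.range n, ((1 + p ^ (2 * m + 1) * z) * (1 + p ^ (2 * m + 1) * z⁻¹))) := by
  have hQ0 : 0 < p ^ 2 := by positivity
  have hQ1 : p ^ 2 < 1 := by nlinarith
  induction n with
  | zero =>
    convert hasSum_single (0 : ℤ) ?_ using 1
    · simp [thP]
    · intro j hj
      rcases lt_or_gt_of_ne hj with h | h
      · simp [thP, h]
      · simp [thP, h]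
  | succ n ih =>
    have s1 := (Equiv.addRight (-1 : ℤ)).hasSum_iff.mpr ih
    have s2 := (Equiv.addRight (1 : ℤ)).hasSum_iff.mpr ih
    have s0 := ih.mul_left (1 + p ^ (4 * n + 2))
    have s1 := s1.mul_left (p ^ (2 * n + 1) * z)
    have s2 := s2.mul_left (p ^ (2 * n + 1) * z⁻¹)
    have s := (s0.add s1).add s2
    have key := thP_rec (p ^ 2) hQ0 hQ1
    have ne : ∀ m : ℕ, (1 - (p ^ 2) ^ (m + 1)) ≠ 0 := fun m => by
      have := pow_lt_one₀ hQ0.le hQ1 (Nat.succ_ne_zero m)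
      simp only [Nat.succ_eq_add_one] at this
      linarith
    set d := (1 - (p ^ 2) ^ (2 * n + 1)) * (1 - (p ^ 2) ^ (2 * n + 1 + 1)) with hd
    have hd0 : d ≠ 0 := mul_ne_zero (ne _) (ne _)
    have t := s.mul_left d⁻¹
    convert t using 1
    · rfl
    · funext j
      rw [eq_inv_mul_iff_mul_eq₀ hd0]
      simp only [Function.comp, Equiv.coe_addRight]
      have r1 := key (n + 1 + j)
      have r2 := key (n + j)
      have r3 := key (n + 1 - j)
      have r4 := key (n - j)
      rw [show (n : ℤ) + 1 + j - 1 = n + j by ring] at r1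
      rw [show (n : ℤ) + 1 - j - 1 = n - j by ring] at r3
      rw [r1] at r2
      rw [r3] at r4
      push_cast
      rw [show (n : ℤ) + (j + -1) = n + j - 1 by ring, show (n : ℤ) - (j + -1) = n + 1 - j by ring,
        show (n : ℤ) + (j + 1) = n + 1 + j by ring, show (n : ℤ) - (j + 1) = n - j - 1 by ring,
        r2, r4, r1, r3]
      have hp : p ≠ 0 := hp0.ne'
      have z1 : z ^ (j + -1) = z ^ j * z⁻¹ := by rw [zpow_add₀ hz.ne']; simp
      have z2 : z ^ (j + 1) = z ^ j * z := by rw [zpow_add₀ hz.ne']; simp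
      have p1 : p ^ ((j + -1) * (j + -1)) = p ^ (j * j) * (p ^ j)⁻¹ ^ 2 * p := by
        rw [show (j + -1) * (j + -1) = j * j + (-j) + (-j) + 1 by ring]
        simp only [zpow_add₀ hp, zpow_neg, zpow_one]; ring
      have p2 : p ^ ((j + 1) * (j + 1)) = p ^ (j * j) * (p ^ j) ^ 2 * p := by
        rw [show (j + 1) * (j + 1) = j * j + j + j + 1 by ring]
        simp only [zpow_add₀ hp, zpow_one]; ring
      have q0 : ∀ i : ℤ, (p ^ 2) ^ i = (p ^ i) ^ 2 := fun i => by
        rw [← zpow_natCast, ← zpow_natCast, ← zpow_mul, ← zpow_mul, mul_comm]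
      rw [z1, z2, p1, p2]
      simp only [hd, q0, zpow_add₀ hp, zpow_sub₀ hp, zpow_natCast, zpow_one]
      have hy : p ^ j ≠ 0 := zpow_ne_zero _ hp
      have hx : p ^ n ≠ 0 := pow_ne_zero _ hp
      rw [show (p ^ 2) ^ (2 * n + 1) = (p ^ n) ^ 4 * p ^ 2 by ring,
        show (p ^ 2) ^ (2 * n + 1 + 1) = (p ^ n) ^ 4 * p ^ 4 by ring,
        show p ^ (4 * n + 2) = (p ^ n) ^ 4 * p ^ 2 by ring,
        show p ^ (2 * n + 1) = (p ^ n) ^ 2 * p by ring]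
      generalize p ^ j = y at *
      generalize p ^ n = x at *
      field_simp
      ring
    · have r1 := key (2 * n + 1)
      have r2 := key (2 * n + 1 + 1)
      rw [show (2 * (n : ℤ) + 1 + 1 - 1) = 2 * n + 1 by ring] at r2
      rw [show (2 * (n : ℤ) + 1 - 1) = 2 * n by ring, r2] at r1
      rw [eq_inv_mul_iff_mul_eq₀ hd0, Finset.prod_range_succ, r1]
      push_cast
      rw [show 2 * ((n : ℤ) + 1) = 2 * n + 1 + 1 by ring, hd,
        show (p ^ 2) ^ (2 * (n : ℤ) + 1) = (p ^ 2) ^ (2 * n + 1) by exact_mod_cast rfl,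
        show (p ^ 2) ^ (2 * (n : ℤ) + 1 + 1) = (p ^ 2) ^ (2 * n + 1 + 1) by exact_mod_cast rfl]
      field_simp
      ring

lemma mult_one_add (f : ℕ → ℝ) (h : Summable f) (h0 : ∀ n, 0 ≤ f n) :
    Multipliable (fun n => 1 + f n) := by
  apply multipliable_one_add_of_summable
  simpa [abs_of_nonneg (h0 _)] using h

lemma mult_one_sub (f : ℕ → ℝ) (h : Summable f) (h0 : ∀ n, 0 ≤ f n) :
    Multipliable (fun n => 1 - f n) := by
  have := multipliable_one_add_of_summable (f := fun n => - f n)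
    (by simpa [abs_of_nonneg (h0 _)] using h)
  simpa [sub_eq_add_neg] using this

lemma summ_pow (Q : ℝ) (h0 : 0 < Q) (h1 : Q < 1) : Summable (fun n : ℕ => Q ^ (n + 1)) :=
  (summable_nat_add_iff 1).mpr (summable_geometric_of_lt_one h0.le h1)

lemma one_sub_pow_pos (Q : ℝ) (h0 : 0 < Q) (h1 : Q < 1) (n : ℕ) : 0 < 1 - Q ^ (n + 1) := by
  have := pow_lt_one₀ h0.le h1 (Nat.succ_ne_zero n)
  simp only [Nat.succ_eq_add_one] at this
  linarith

lemma mult_inv (Q : ℝ) (h0 : 0 < Q) (h1 : Q < 1) :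
    Multipliable (fun n : ℕ => (1 - Q ^ (n + 1))⁻¹) := by
  have e : (fun n : ℕ => (1 - Q ^ (n + 1))⁻¹) =
      fun n : ℕ => 1 + Q ^ (n + 1) * (1 - Q ^ (n + 1))⁻¹ := by
    funext n
    have := (one_sub_pow_pos Q h0 h1 n).ne'
    field_simp
    ring
  rw [e]
  have hb : ∀ n : ℕ, 0 ≤ Q ^ (n + 1) * (1 - Q ^ (n + 1))⁻¹ := fun n =>
    mul_nonneg (by positivity) (inv_nonneg.mpr (one_sub_pow_pos Q h0 h1 n).le)
  refine mult_one_add _ ?_ hb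
  refine Summable.of_nonneg_of_le hb (fun n => ?_) ((summ_pow Q h0 h1).mul_right (1 - Q)⁻¹)
  gcongr
  calc Q ^ (n + 1) ≤ Q ^ 1 := pow_le_pow_of_le_one h0.le h1.le (by omega)
    _ = Q := pow_one Q

lemma thP_tendsto (Q : ℝ) (h0 : 0 < Q) (h1 : Q < 1) :
    Tendsto (thP Q) atTop (𝓝 (∏' n : ℕ, (1 - Q ^ (n + 1))⁻¹)) := by
  have h := (mult_inv Q h0 h1).hasProd.tendsto_prod_nat
  have h2 : Tendsto Int.toNat atTop atTop := by
    rw [tendsto_atTop]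
    intro b
    filter_upwards [eventually_ge_atTop (b : ℤ)] with a ha
    omega
  refine (h.comp h2).congr' ?_
  filter_upwards [eventually_ge_atTop (0 : ℤ)] with a ha
  simp [thP, not_lt.mpr ha]

lemma thP_nonneg (Q : ℝ) (h0 : 0 < Q) (h1 : Q < 1) (m : ℤ) : 0 ≤ thP Q m := by
  unfold thP
  split_ifs
  · rfl
  · exact Finset.prod_nonneg fun i _ => inv_nonneg.mpr (one_sub_pow_pos Q h0 h1 i).le

lemma thP_bdd (Q : ℝ) (h0 : 0 < Q) (h1 : Q < 1) : ∃ C, 0 ≤ C ∧ ∀ m, thP Q m ≤ C := by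
  obtain ⟨C, hC⟩ := (mult_inv Q h0 h1).hasProd.tendsto_prod_nat.bddAbove_range
  have hC' : ∀ n, ∏ i ∈ Finset.range n, (1 - Q ^ (i + 1))⁻¹ ≤ C := fun n => hC ⟨n, rfl⟩
  have hC0 : 0 ≤ C := le_trans (by simp) (hC' 0)
  refine ⟨C, hC0, fun m => ?_⟩
  unfold thP
  split_ifs
  · exact hC0
  · exact hC' _

lemma theta_summable (p z : ℝ) (hp0 : 0 < p) (hp1 : p < 1) (hz : 0 < z) :
    Summable (fun j : ℤ => p ^ (j * j) * z ^ j) := by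
  have hl : Real.log p < 0 := Real.log_neg hp0 hp1
  have h := (summable_jacobiTheta₂_term_iff
    (Complex.I * ((-Real.log z / (2 * Real.pi) : ℝ) : ℂ))
    (Complex.I * ((-Real.log p / Real.pi : ℝ) : ℂ))).mpr (by
      simp only [Complex.I_mul_im, Complex.ofReal_re]
      exact div_pos (by linarith) Real.pi_pos)
  refine h.norm.congr fun j => ?_
  rw [norm_jacobiTheta₂_term]
  simp only [Complex.I_mul_im, Complex.ofReal_re]
  rw [← Real.rpow_intCast, ← Real.rpow_intCast, Real.rpow_def_of_pos hp0, Real.rpow_def_of_pos hz,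
    ← Real.exp_add]
  congr 1
  have := Real.pi_ne_zero
  push_cast
  field_simp
  ring

lemma jtp (p z : ℝ) (hp0 : 0 < p) (hp1 : p < 1) (hz : 0 < z) :
    (∑' j : ℤ, p ^ (j * j) * z ^ j) =
      ∏' m : ℕ, ((1 - (p ^ 2) ^ (m + 1)) *
        ((1 + p ^ (2 * m + 1) * z) * (1 + p ^ (2 * m + 1) * z⁻¹))) ∧
    Multipliable (fun m : ℕ => ((1 - (p ^ 2) ^ (m + 1)) *
        ((1 + p ^ (2 * m + 1) * z) * (1 + p ^ (2 * m + 1) * z⁻¹)))) := by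
  have hQ0 : 0 < p ^ 2 := by positivity
  have hQ1 : p ^ 2 < 1 := by nlinarith
  have sp : Summable (fun m : ℕ => p ^ (2 * m + 1)) := by
    have := (summable_geometric_of_lt_one hQ0.le hQ1).mul_right p
    refine this.congr fun m => ?_
    ring
  have mE := mult_one_sub _ (summ_pow _ hQ0 hQ1) (fun n => by positivity)
  have m1 := mult_one_add _ (sp.mul_right z) (fun n => by positivity)
  have m2 := mult_one_add _ (sp.mul_right z⁻¹) (fun n => by positivity)
  have mL := mult_inv _ hQ0 hQ1
  have m12 := m1.mul m2
  refine ⟨?_, mE.mul m12⟩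
  rw [mE.tprod_mul m12]
  have hEL : (∏' n : ℕ, (1 - (p ^ 2) ^ (n + 1))) * (∏' n : ℕ, (1 - (p ^ 2) ^ (n + 1))⁻¹) = 1 := by
    rw [← mE.tprod_mul mL]
    have : ∀ n : ℕ, (1 - (p ^ 2) ^ (n + 1)) * (1 - (p ^ 2) ^ (n + 1))⁻¹ = 1 := fun n =>
      mul_inv_cancel₀ (one_sub_pow_pos _ hQ0 hQ1 n).ne'
    simp only [this, tprod_one]
  have tP := thP_tendsto _ hQ0 hQ1
  obtain ⟨C, hC0, hC⟩ := thP_bdd _ hQ0 hQ1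
  have hnn := thP_nonneg _ hQ0 hQ1
  set L := ∏' n : ℕ, (1 - (p ^ 2) ^ (n + 1))⁻¹ with hL
  set E := ∏' n : ℕ, (1 - (p ^ 2) ^ (n + 1)) with hE
  have ts := theta_summable p z hp0 hp1 hz
  have cast : Tendsto (fun n : ℕ => (n : ℤ)) atTop atTop := tendsto_natCast_atTop_atTop
  have lim1 : Tendsto (fun n : ℕ => ∑' j : ℤ,
      thP (p ^ 2) (n + j) * thP (p ^ 2) (n - j) * (p ^ (j * j) * z ^ j)) atTop
      (𝓝 (∑' j : ℤ, L * L * (p ^ (j * j) * z ^ j))) := by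
    refine tendsto_tsum_of_dominated_convergence (ts.mul_left (C * C)) ?_ ?_
    · intro j
      refine Tendsto.mul_const _ (Tendsto.mul ?_ ?_)
      · exact tP.comp (tendsto_atTop_add_const_right _ j cast)
      · exact tP.comp (tendsto_atTop_add_const_right _ (-j) cast)
    · refine Eventually.of_forall fun n j => ?_
      have : 0 ≤ p ^ (j * j) * z ^ j := by positivity
      rw [Real.norm_of_nonneg (mul_nonneg (mul_nonneg (hnn _) (hnn _)) this)]
      exact mul_le_mul_of_nonneg_right (mul_le_mul (hC _) (hC _) (hnn _) hC0) this
  have lim2 : Tendsto (fun n : ℕ => thP (p ^ 2) (2 * n) *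
        ∏ m ∈ Finset.range n, ((1 + p ^ (2 * m + 1) * z) * (1 + p ^ (2 * m + 1) * z⁻¹))) atTop
      (𝓝 (L * ∏' m : ℕ, ((1 + p ^ (2 * m + 1) * z) * (1 + p ^ (2 * m + 1) * z⁻¹)))) := by
    refine Tendsto.mul ?_ m12.hasProd.tendsto_prod_nat
    exact tP.comp (cast.const_mul_atTop' (by norm_num))
  have eqn := tendsto_nhds_unique lim1
    (lim2.congr fun n => ((finite_jtp p z hp0 hp1 hz n).tsum_eq).symm)
  rw [tsum_mul_left] at eqn
  calc (∑' j : ℤ, p ^ (j * j) * z ^ j)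
      = (E * L) * (E * L) * ∑' j : ℤ, p ^ (j * j) * z ^ j := by rw [hEL]; ring
    _ = E * E * (L * L * ∑' j : ℤ, p ^ (j * j) * z ^ j) := by ring
    _ = E * (E * L) * ∏' m : ℕ, ((1 + p ^ (2 * m + 1) * z) * (1 + p ^ (2 * m + 1) * z⁻¹)) := by
        rw [eqn]; ring
    _ = _ := by rw [hEL]; ring


/-- The `q`-Gaussian–Mehta (Jackson theta) identity: for `0 < q < 1` and `k > 0`,
`(∑_{j∈ℤ} q^{(k−j)²/4}) · ∏_{j=1}^{∞} (1−q^{j+k})/(1−q^j)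
 = q^{k²/4} ∏_{j=1}^{∞} (1−q^{j/2})(1−q^{j+k})(1+q^{j/2−1/4+k/2})(1+q^{j/2−1/4−k/2})/(1−q^j)`. -/
theorem q_gauss_theta_product (q k : ℝ) (hq0 : 0 < q) (hq1 : q < 1) (hk : 0 < k) :
    (∑' j : ℤ, q ^ ((k - (j : ℝ)) ^ 2 / 4)) *
        (∏' j : ℕ, (1 - q ^ (((j : ℝ) + 1) + k)) / (1 - q ^ ((j : ℝ) + 1))) =
      q ^ (k ^ 2 / 4) *
        ∏' j : ℕ,
          ((1 - q ^ (((j : ℝ) + 1) / 2)) * (1 - q ^ (((j : ℝ) + 1) + k)) *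
              (1 + q ^ (((j : ℝ) + 1) / 2 - 1 / 4 + k / 2)) *
              (1 + q ^ (((j : ℝ) + 1) / 2 - 1 / 4 - k / 2))) /
            (1 - q ^ ((j : ℝ) + 1)) := by
  have hp0 : 0 < q ^ (1 / 4 : ℝ) := Real.rpow_pos_of_pos hq0 _
  have hp1 : q ^ (1 / 4 : ℝ) < 1 := Real.rpow_lt_one hq0.le hq1 (by norm_num)
  have hz : 0 < q ^ (-k / 2) := Real.rpow_pos_of_pos hq0 _
  obtain ⟨hj, hm⟩ := jtp _ _ hp0 hp1 hz
  have e1 : ∀ j : ℤ, q ^ ((k - (j : ℝ)) ^ 2 / 4) =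
      q ^ (k ^ 2 / 4) * ((q ^ (1 / 4 : ℝ)) ^ (j * j) * (q ^ (-k / 2)) ^ j) := fun j => by
    rw [← Real.rpow_intCast, ← Real.rpow_intCast, ← Real.rpow_mul hq0.le, ← Real.rpow_mul hq0.le,
      ← Real.rpow_add hq0, ← Real.rpow_add hq0]
    congr 1
    push_cast
    ring
  have mr : Multipliable (fun j : ℕ =>
      (1 - q ^ (((j : ℝ) + 1) + k)) / (1 - q ^ ((j : ℝ) + 1))) := by
    have a := (summ_pow q hq0 hq1).mul_right (q ^ k)
    have b := (mult_one_sub _ a (fun n => by positivity)).mul (mult_inv q hq0 hq1)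
    refine b.congr fun n => ?_
    rw [Real.rpow_add hq0, div_eq_mul_inv]
    norm_cast
  simp only [e1]
  rw [tsum_mul_left, hj, mul_assoc, ← hm.tprod_mul mr]
  congr 1
  refine tprod_congr fun j => ?_
  have a1 : ((q ^ (1 / 4 : ℝ)) ^ 2) ^ (j + 1) = q ^ (((j : ℝ) + 1) / 2) := by
    rw [← pow_mul, ← Real.rpow_natCast, ← Real.rpow_mul hq0.le]
    congr 1
    push_cast
    ring
  have a2 : (q ^ (1 / 4 : ℝ)) ^ (2 * j + 1) * q ^ (-k / 2) =
      q ^ (((j : ℝ) + 1) / 2 - 1 / 4 - k / 2) := by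
    rw [← Real.rpow_natCast, ← Real.rpow_mul hq0.le, ← Real.rpow_add hq0]
    congr 1
    push_cast
    ring
  have a3 : (q ^ (1 / 4 : ℝ)) ^ (2 * j + 1) * (q ^ (-k / 2))⁻¹ =
      q ^ (((j : ℝ) + 1) / 2 - 1 / 4 + k / 2) := by
    rw [← Real.rpow_natCast, ← Real.rpow_mul hq0.le, ← Real.rpow_neg hq0.le, ← Real.rpow_add hq0]
    congr 1
    push_cast
    ring
  rw [a1, a2, a3]
  ring
end

section
/- Let R be a reduced irreducible root system and e a positive integer. The set {b ∈ Q : −(b_−, θ) < e, or (−(b_−, θ) = e and u_b⁻¹(θ) ∈ R_−)} of weights b in the root lattice Q has cardinality eⁿ, where b_− is the antidominant representative of b and u_b ∈ W the shortest element with u_b(b) = b_−. -/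
open scoped RealInnerProductSpace Pointwise BigOperators

noncomputable section

/-- Euclidean `n`-space, the ambient space of the root system. -/
abbrev V (n : ℕ) := EuclideanSpace ℝ (Fin n)

/-- An element `w ∘ b'` of the extended affine Weyl group `Ŵ = W ⋉ P'`:
`w` is the (finite) Weyl-group part, `b` the translation part. -/
structure ExtElem (n : ℕ) where
  w : V n ≃ₗᵢ[ℝ] V n
  b : V n

namespace ExtElem

variable {n : ℕ}

/-- The identity element of `Ŵ`. -/
def one : ExtElem n := ⟨LinearIsometryEquiv.refl ℝ (V n), 0⟩

/-- Multiplication in `Ŵ`: `(w₁ b₁')·(w₂ b₂') = (w₁w₂)((w₂⁻¹ b₁ + b₂)')`. -/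
def mul (x y : ExtElem n) : ExtElem n := ⟨y.w.trans x.w, y.w.symm x.b + y.b⟩

/-- Inversion in `Ŵ`. -/
def inv (x : ExtElem n) : ExtElem n := ⟨x.w.symm, -(x.w x.b)⟩

/-- The action of `Ŵ` on affine roots `[z, ζ]`:  `(w b')([z,ζ]) = [w z, ζ − (z,b)]`. -/
def act (x : ExtElem n) (p : V n × ℝ) : V n × ℝ := (x.w p.1, p.2 - ⟪p.1, x.b⟫)

/-- The affine action of `Ŵ` on `ℝⁿ`: `(w b')((z)) = w(z + b)`. -/
def affAct (x : ExtElem n) (z : V n) : V n := x.w (z + x.b)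

/-- A Weyl group element `w` viewed in `Ŵ`. -/
def we (u : V n ≃ₗᵢ[ℝ] V n) : ExtElem n := ⟨u, 0⟩

/-- A translation `b'` viewed in `Ŵ`. -/
def tr (b : V n) : ExtElem n := ⟨LinearIsometryEquiv.refl ℝ (V n), b⟩

end ExtElem

variable {n : ℕ}

/-- `ν_α = (α,α)/2`. -/
def nuv (α : V n) : ℝ := ⟪α, α⟫ / 2

/-- The coroot pairing `(b, α∨) = 2(b,α)/(α,α)`. -/
def pairv (b α : V n) : ℝ := 2 * ⟪b, α⟫ / ⟪α, α⟫

/-- The positive affine roots `R̃₊ = R₊ ∪ {[α, ν_α j] : α ∈ R, j > 0}`, realized as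
pairs `(α, m)` with `m ∈ ν_α ℤ`. -/
def AffPlus (R Rplus : Set (V n)) : Set (V n × ℝ) :=
  {p | p.1 ∈ R ∧ (∃ j : ℤ, p.2 = nuv p.1 * j) ∧ (0 < p.2 ∨ (p.2 = 0 ∧ p.1 ∈ Rplus))}

/-- `λ(ŵ) = R̃₊ ∩ ŵ⁻¹(R̃₋)`. -/
def lamSet (R Rplus : Set (V n)) (x : ExtElem n) : Set (V n × ℝ) :=
  AffPlus R Rplus ∩ {p | x.act p ∈ -AffPlus R Rplus}

/-- The length `l(ŵ) = |λ(ŵ)|`. -/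
noncomputable def len (R Rplus : Set (V n)) (x : ExtElem n) : ℕ :=
  (lamSet R Rplus x).ncard

/-- Membership in the weight lattice `P`: `(α∨, b) ∈ ℤ` for all roots. -/
def inLat (R : Set (V n)) (b : V n) : Prop :=
  ∀ α ∈ R, ∃ m : ℤ, ⟪α, b⟫ = nuv α * m

/-- Reflections `s_α`, `α ∈ R`. -/
def IsReflection (R : Set (V n)) (g : V n ≃ₗᵢ[ℝ] V n) : Prop :=
  ∃ α ∈ R, ∀ z, g z = z - pairv z α • α

/-- The Weyl group `W`, generated by the reflections `s_α`, `α ∈ R`. -/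
def Weyl (R : Set (V n)) : Subgroup (V n ≃ₗᵢ[ℝ] V n) :=
  Subgroup.closure {g | IsReflection R g}

/-- `π_b = b·u_b⁻¹ = u_b⁻¹ ∘ (u_b b)' ∈ Ŵ` for `u ∈ W`. -/
def piE (u : V n ≃ₗᵢ[ℝ] V n) (b : V n) : ExtElem n := ⟨u.symm, u b⟩

/-- `u = u_b`: the shortest element of `W` with `u(b) = b₋ ∈ P₋`, characterized by
`u(b)` antidominant together with `α ∈ λ(u) ⇒ (α, b) ≠ 0`. -/
def IsUb (R Rplus : Set (V n)) (b : V n) (u : V n ≃ₗᵢ[ℝ] V n) : Prop :=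
  u ∈ Weyl R ∧ (∀ α ∈ Rplus, ⟪u b, α⟫ ≤ 0) ∧
    ∀ α ∈ Rplus, u α ∈ -Rplus → ⟪α, b⟫ ≠ 0

end

namespace CAP

structure RS (R Rplus : Set (V n)) (simple : Fin n → V n) (θ : V n) : Prop where
  hfin : R.Finite
  hR : R = Rplus ∪ (-Rplus)
  h0 : (0 : V n) ∉ R
  hsimple : ∀ i, simple i ∈ Rplus
  hindep : LinearIndependent ℝ simple
  hpos_sum : ∀ α ∈ Rplus, ∃ c : Fin n → ℕ, α = ∑ i, (c i : ℝ) • simple i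
  hrefl : ∀ α ∈ R, ∀ β ∈ R, β - pairv β α • α ∈ R
  hcart : ∀ α ∈ R, ∀ β ∈ R, ∃ m : ℤ, pairv β α = m
  hirr : ∀ S T : Set (V n), S ∪ T = R → (∀ a ∈ S, ∀ b ∈ T, ⟪a, b⟫ = 0) →
      S = ∅ ∨ T = ∅
  hshort : ∀ α ∈ R, 2 ≤ ⟪α, α⟫
  hθ : θ ∈ Rplus
  hθ2 : ⟪θ, θ⟫ = 2
  hθdom : ∀ α ∈ Rplus, 0 ≤ ⟪θ, α⟫

def InC (simple : Fin n → V n) (v : V n) : Prop :=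
  ∃ c : Fin n → ℝ, (∀ i, 0 ≤ c i) ∧ v = ∑ i, c i • simple i

def InQ (simple : Fin n → V n) (v : V n) : Prop :=
  ∃ l : Fin n → ℤ, v = ∑ i, (l i : ℝ) • simple i

lemma InC.add {simple : Fin n → V n} {v w : V n} (hv : InC simple v) (hw : InC simple w) :
    InC simple (v + w) := by
  obtain ⟨c, hc, rfl⟩ := hv
  obtain ⟨d, hd, rfl⟩ := hw
  exact ⟨fun i => c i + d i, fun i => add_nonneg (hc i) (hd i), by
    simp [add_smul, Finset.sum_add_distrib]⟩

lemma InC.smul {simple : Fin n → V n} {v : V n} (hv : InC simple v) {t : ℝ} (ht : 0 ≤ t) :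
    InC simple (t • v) := by
  obtain ⟨c, hc, rfl⟩ := hv
  exact ⟨fun i => t * c i, fun i => mul_nonneg ht (hc i), by
    simp [Finset.smul_sum, smul_smul]⟩

lemma InC.zero {simple : Fin n → V n} : InC simple 0 :=
  ⟨fun _ => 0, fun _ => le_rfl, by simp⟩

lemma InC.simple {simple : Fin n → V n} (i : Fin n) : InC simple (simple i) := by
  classical
  refine ⟨fun j => if j = i then 1 else 0, fun j => by dsimp only; split_ifs <;> norm_num, ?_⟩
  simp

lemma InQ.add {simple : Fin n → V n} {v w : V n} (hv : InQ simple v) (hw : InQ simple w) :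
    InQ simple (v + w) := by
  obtain ⟨c, rfl⟩ := hv
  obtain ⟨d, rfl⟩ := hw
  exact ⟨fun i => c i + d i, by simp [add_smul, Finset.sum_add_distrib]⟩

lemma InQ.zsmul {simple : Fin n → V n} {v : V n} (hv : InQ simple v) (m : ℤ) :
    InQ simple ((m : ℝ) • v) := by
  obtain ⟨c, rfl⟩ := hv
  exact ⟨fun i => m * c i, by simp [Finset.smul_sum, smul_smul]⟩

lemma InQ.neg {simple : Fin n → V n} {v : V n} (hv : InQ simple v) :
    InQ simple (-v) := by
  have := hv.zsmul (-1)
  simpa using this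

lemma coef_inj {simple : Fin n → V n} (h : LinearIndependent ℝ simple) {a b : Fin n → ℝ}
    (hab : ∑ i, a i • simple i = ∑ i, b i • simple i) (i : Fin n) : a i = b i := by
  have := Fintype.linearIndependent_iff.1 h (fun i => a i - b i) (by
    simp [sub_smul, Finset.sum_sub_distrib, hab]) i
  linarith

lemma pairv_neg (b α : V n) : pairv b (-α) = -pairv b α := by
  simp [pairv, inner_neg_right, neg_div]

lemma pairv_add (b c α : V n) : pairv (b + c) α = pairv b α + pairv c α := by
  simp only [pairv, inner_add_left]; ring

lemma pairv_smul (t : ℝ) (b α : V n) : pairv (t • b) α = t * pairv b α := by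
  simp only [pairv, inner_smul_left]; simp; ring

variable {R Rplus : Set (V n)} {simple : Fin n → V n} {θ : V n}

lemma RS.pos (h : RS R Rplus simple θ) {α : V n} (hα : α ∈ Rplus) : α ∈ R := by
  rw [h.hR]; exact Or.inl hα

lemma RS.neg (h : RS R Rplus simple θ) {α : V n} (hα : α ∈ R) : -α ∈ R := by
  rw [h.hR] at hα ⊢
  rcases hα with hα | hα
  · right; simpa using hα
  · left; simpa using hα

lemma RS.cases (h : RS R Rplus simple θ) {α : V n} (hα : α ∈ R) : α ∈ Rplus ∨ -α ∈ Rplus := by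
  rw [h.hR] at hα
  simpa using hα

lemma RS.npos (h : RS R Rplus simple θ) {α : V n} (hα : α ∈ R) : 0 < ⟪α, α⟫ := by
  linarith [h.hshort α hα]

lemma pairv_mul {α : V n} (z : V n) (hα : 0 < ⟪α, α⟫) :
    pairv z α * ⟪α, α⟫ = 2 * ⟪z, α⟫ := by
  unfold pairv; field_simp

lemma refl_inner {α : V n} (z : V n) (hα : 0 < ⟪α, α⟫) :
    ⟪z - pairv z α • α, α⟫ = -⟪z, α⟫ := by
  rw [inner_sub_left, real_inner_smul_left, pairv_mul z hα]; ring

lemma refl_norm {α : V n} (z : V n) (hα : 0 < ⟪α, α⟫) :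
    ⟪z - pairv z α • α, z - pairv z α • α⟫ = ⟪z, z⟫ := by
  rw [inner_sub_right, real_inner_smul_right, refl_inner z hα, inner_sub_left,
    real_inner_smul_left, real_inner_comm α z]
  ring

lemma refl_refl {α : V n} (z : V n) (hα : 0 < ⟪α, α⟫) :
    (z - pairv z α • α) - pairv (z - pairv z α • α) α • α = z := by
  have : pairv (z - pairv z α • α) α = - pairv z α := by
    rw [pairv.eq_1 (z - pairv z α • α) α, refl_inner z hα]; unfold pairv; ring
  rw [this]; simp

noncomputable def RS.basis (h : RS R Rplus simple θ) : Module.Basis (Fin n) ℝ (V n) :=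
  basisOfLinearIndependentOfCardEqFinrank' simple h.hindep (by simp)

lemma RS.basis_apply (h : RS R Rplus simple θ) (i : Fin n) : h.basis i = simple i := by
  simp [RS.basis]

lemma RS.exists_rho (h : RS R Rplus simple θ) : ∃ ρ : V n, ∀ i, ⟪simple i, ρ⟫ = 1 := by
  let f : V n →ₗ[ℝ] ℝ := h.basis.constr ℝ (fun _ => (1 : ℝ))
  refine ⟨(InnerProductSpace.toDual ℝ (V n)).symm (LinearMap.toContinuousLinearMap f), fun i => ?_⟩
  rw [real_inner_comm, InnerProductSpace.toDual_symm_apply]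
  simp [f, ← h.basis_apply]

lemma RS.posC (h : RS R Rplus simple θ) {α : V n} (hα : α ∈ Rplus) : InC simple α := by
  obtain ⟨c, hc⟩ := h.hpos_sum α hα
  exact ⟨fun i => c i, fun i => by positivity, hc⟩

lemma RS.rootQ (h : RS R Rplus simple θ) {α : V n} (hα : α ∈ R) : InQ simple α := by
  have key : ∀ β ∈ Rplus, InQ simple β := by
    intro β hβ
    obtain ⟨c, hc⟩ := h.hpos_sum β hβ
    exact ⟨fun i => c i, by simpa using hc⟩
  rcases h.cases hα with hα | hα
  · exact key _ hα
  · simpa using (key _ hα).neg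

lemma InC.ht {v ρ : V n} (hρ : ∀ i, ⟪simple i, ρ⟫ = 1) (hv : InC simple v) : 0 ≤ ⟪v, ρ⟫ := by
  obtain ⟨c, hc, rfl⟩ := hv
  rw [sum_inner]
  refine Finset.sum_nonneg fun i _ => ?_
  rw [real_inner_smul_left, hρ]; simpa using hc i

lemma RS.ht_pos (h : RS R Rplus simple θ) {α ρ : V n} (hρ : ∀ i, ⟪simple i, ρ⟫ = 1)
    (hα : α ∈ Rplus) : 0 < ⟪α, ρ⟫ := by
  refine lt_of_le_of_ne ((h.posC hα).ht hρ) ?_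
  intro h0
  obtain ⟨c, hc, e⟩ := h.posC hα
  rw [e, sum_inner] at h0
  simp only [real_inner_smul_left, hρ, mul_one] at h0
  have := (Finset.sum_eq_zero_iff_of_nonneg (fun i _ => hc i)).1 h0.symm
  apply h.h0
  have e0 : α = 0 := by
    rw [e]; exact Finset.sum_eq_zero fun i hi => by rw [this i hi, zero_smul]
  rw [← e0]; exact h.pos hα

lemma RS.simple_inner (h : RS R Rplus simple θ) {i j : Fin n} (hij : i ≠ j) :
    ⟪simple j, simple i⟫ ≤ 0 := by
  classical
  by_contra hc
  push Not at hc
  have hi := h.npos (h.pos (h.hsimple i))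
  have hp : 0 < pairv (simple j) (simple i) := by unfold pairv; positivity
  have hm := h.hrefl _ (h.pos (h.hsimple i)) _ (h.pos (h.hsimple j))
  set p := pairv (simple j) (simple i)
  let d : Fin n → ℝ := fun k => (if k = j then 1 else 0) - (if k = i then p else 0)
  have hd : simple j - p • simple i = ∑ k, d k • simple k := by
    simp [d, sub_smul, Finset.sum_sub_distrib]
  rcases h.cases hm with hm | hm
  · obtain ⟨c, hc0, hc⟩ := h.posC hm
    have := coef_inj h.hindep (hd.symm.trans hc) i
    have h2 := hc0 i
    simp [d, hij] at this
    linarith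
  · obtain ⟨c, hc0, hc⟩ := h.posC hm
    have : ∑ k, d k • simple k = ∑ k, (-c k) • simple k := by
      rw [← hd]; simp [← hc]
    have := coef_inj h.hindep this j
    have h2 := hc0 j
    simp [d, hij.symm] at this
    linarith

lemma RS.theta_supp (h : RS R Rplus simple θ) :
    ∃ c : Fin n → ℝ, (∀ i, 0 < c i) ∧ θ = ∑ i, c i • simple i := by
  classical
  obtain ⟨ρ, hρ⟩ := h.exists_rho
  obtain ⟨c, hc, e⟩ := h.posC h.hθ
  refine ⟨c, ?_, e⟩
  by_contra hne
  push Not at hne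
  obtain ⟨j, hj⟩ := hne
  have hj : c j = 0 := le_antisymm hj (hc j)
  -- simple roots outside the support are orthogonal to those inside
  have horth : ∀ i j, c i ≠ 0 → c j = 0 → ⟪simple j, simple i⟫ = 0 := by
    intro i j hi hj
    have h1 := h.hθdom _ (h.hsimple j)
    rw [e, sum_inner] at h1
    simp only [real_inner_smul_left] at h1
    have hle : ∀ k ∈ Finset.univ, c k * ⟪simple k, simple j⟫ ≤ 0 := by
      intro k _
      by_cases hk : k = j
      · subst hk; simp [hj]
      · exact mul_nonpos_of_nonneg_of_nonpos (hc k) (h.simple_inner (Ne.symm hk))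
    have h2 := (Finset.sum_eq_zero_iff_of_nonpos hle).1
      (le_antisymm (Finset.sum_nonpos hle) h1) i (Finset.mem_univ _)
    rw [real_inner_comm]
    exact (mul_eq_zero.1 h2).resolve_left hi
  let K : Submodule ℝ (V n) := Submodule.span ℝ (simple '' {i | c i ≠ 0})
  have hK : ∀ i, c i ≠ 0 → simple i ∈ K := fun i hi => Submodule.subset_span ⟨i, hi, rfl⟩
  have horthK : ∀ x : V n, (∀ i, c i ≠ 0 → ⟪x, simple i⟫ = 0) → ∀ y ∈ K, ⟪x, y⟫ = 0 := by
    intro x hx y hy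
    induction hy using Submodule.span_induction with
    | mem y hy => obtain ⟨i, hi, rfl⟩ := hy; exact hx i hi
    | zero => simp
    | add a b _ _ ha hb => rw [inner_add_right, ha, hb, add_zero]
    | smul t a _ ha => rw [real_inner_smul_right, ha, mul_zero]
  let S : Set (V n) := {a | a ∈ R ∧ a ∈ K}
  let T : Set (V n) := {a | a ∈ R ∧ ∀ i, c i ≠ 0 → ⟪a, simple i⟫ = 0}
  have hpos : ∀ α ∈ Rplus, α ∈ S ∪ T := by
    by_contra hbad
    push Not at hbad
    have hbf : {α | α ∈ Rplus ∧ α ∉ S ∪ T}.Finite :=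
      h.hfin.subset fun a ha => h.pos ha.1
    obtain ⟨α, ⟨hα, hαn⟩, hmin⟩ := Set.exists_min_image _ (fun a => ⟪a, ρ⟫) hbf
      (by obtain ⟨a, ha, hb⟩ := hbad; exact ⟨a, ha, hb⟩)
    obtain ⟨d, hd, ed⟩ := h.posC hα
    have : ∃ i, 0 < ⟪α, simple i⟫ := by
      by_contra hcon
      push Not at hcon
      have h1 := h.npos (h.pos hα)
      nth_rewrite 2 [ed] at h1
      rw [inner_sum] at h1
      have : ∑ i, ⟪α, d i • simple i⟫ ≤ 0 := Finset.sum_nonpos fun i _ => by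
        rw [real_inner_smul_right]
        exact mul_nonpos_of_nonneg_of_nonpos (hd i) (hcon i)
      linarith
    obtain ⟨i, hi⟩ := this
    have hii := h.npos (h.pos (h.hsimple i))
    have hm := h.hrefl _ (h.pos (h.hsimple i)) _ (h.pos hα)
    have hp : 0 < pairv α (simple i) := by unfold pairv; positivity
    have hin := refl_inner α hii
    set p := pairv α (simple i) with hpdef
    rcases h.cases hm with hm' | hm'
    · have hST : α - p • simple i ∈ S ∪ T := by
        by_contra hn
        have := hmin _ ⟨hm', hn⟩
        simp only [inner_sub_left, real_inner_smul_left, hρ] at this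
        linarith
      apply hαn
      by_cases hci : c i = 0
      · rcases hST with hS | hT
        · have := horthK (simple i) (fun k hk => horth k i hk hci) _ hS.2
          rw [real_inner_comm] at this
          linarith
        · right
          refine ⟨h.pos hα, fun k hk => ?_⟩
          have := hT.2 k hk
          rw [inner_sub_left, real_inner_smul_left, horth k i hk hci] at this
          linarith
      · rcases hST with hS | hT
        · left
          refine ⟨h.pos hα, ?_⟩
          have := K.add_mem hS.2 (K.smul_mem p (hK i hci))
          simpa using this
        · have := hT.2 i hci
          linarith
    · -- α is a multiple of simple i
      obtain ⟨f, hf, ef⟩ := h.posC hm'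
      have hsum : ∑ k, (d k + f k) • simple k = ∑ k, (if k = i then p else 0) • simple k := by
        simp only [add_smul, Finset.sum_add_distrib, ← ed, ← ef]
        simp
      have hz : ∀ k, k ≠ i → d k = 0 := by
        intro k hk
        have := coef_inj h.hindep hsum k
        simp [hk] at this
        linarith [hd k, hf k]
      have hα' : α = d i • simple i := by
        rw [ed]
        exact Finset.sum_eq_single i (fun k _ hk => by rw [hz k hk, zero_smul]) (by simp)
      apply hαn
      by_cases hci : c i = 0
      · right
        refine ⟨h.pos hα, fun k hk => ?_⟩
        rw [hα', real_inner_smul_left, horth k i hk hci, mul_zero]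
      · left
        exact ⟨h.pos hα, by rw [hα']; exact K.smul_mem _ (hK i hci)⟩
  have hunion : S ∪ T = R := by
    apply Set.Subset.antisymm
    · rintro a (ha | ha) <;> exact ha.1
    · intro a ha
      rcases h.cases ha with hp | hp
      · exact hpos a hp
      · rcases hpos _ hp with hS | hT
        · left; exact ⟨ha, by simpa using K.neg_mem hS.2⟩
        · right; exact ⟨ha, fun i hi => by simpa using hT.2 i hi⟩
  rcases h.hirr S T hunion (fun a ha b hb => by
    rw [real_inner_comm]; exact horthK b hb.2 a ha.2) with hS | hT
  · have : θ ∈ S := by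
      refine ⟨h.pos h.hθ, ?_⟩
      rw [e]
      refine K.sum_mem fun i _ => ?_
      by_cases hci : c i = 0
      · simp [hci]
      · exact K.smul_mem _ (hK i hci)
    rw [hS] at this; exact this
  · have : simple j ∈ T := ⟨h.pos (h.hsimple j), fun i hi => horth i j hi hj⟩
    rw [hT] at this; exact this

/-- dominant case of: `θ` is the highest coroot -/
lemma RS.theta_ge_dom (h : RS R Rplus simple θ) {β : V n} (hβ : β ∈ Rplus)
    (hdom : ∀ i, 0 ≤ ⟪β, simple i⟫) : InC simple (θ - (2 / ⟪β, β⟫) • β) := by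
  have hN := h.hshort β (h.pos hβ)
  have hq0 : 0 < ⟪β, θ⟫ := by
    obtain ⟨c, hc, e⟩ := h.theta_supp
    obtain ⟨d, hd, ed⟩ := h.posC hβ
    have hnn : ∀ i ∈ Finset.univ, 0 ≤ c i * ⟪β, simple i⟫ := fun i _ =>
      mul_nonneg (hc i).le (hdom i)
    have hs : ⟪β, θ⟫ = ∑ i, c i * ⟪β, simple i⟫ := by
      rw [e, inner_sum]; simp only [real_inner_smul_right]
    rw [hs]
    refine lt_of_le_of_ne (Finset.sum_nonneg hnn) fun h0 => ?_
    have hz := (Finset.sum_eq_zero_iff_of_nonneg hnn).1 h0.symm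
    have h1 := h.npos (h.pos hβ)
    nth_rewrite 2 [ed] at h1
    rw [inner_sum] at h1
    have : ∑ i, ⟪β, d i • simple i⟫ = 0 := Finset.sum_eq_zero fun i hi => by
      rw [real_inner_smul_right, (mul_eq_zero.1 (hz i hi)).resolve_left (hc i).ne', mul_zero]
    linarith
  have hpq : pairv β θ = ⟪β, θ⟫ := by unfold pairv; rw [h.hθ2]; ring
  have hm := h.hrefl _ (h.pos h.hθ) _ (h.pos hβ)
  rw [hpq] at hm
  have hpos : InC simple (⟪β, θ⟫ • θ - β) := by
    rcases h.cases hm with hm | hm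
    · exfalso
      have := h.hθdom _ hm
      rw [inner_sub_right, real_inner_smul_right, h.hθ2, real_inner_comm] at this
      linarith
    · have := h.posC hm
      simpa using this
  set q := ⟪β, θ⟫ with hqd
  obtain ⟨p, hp⟩ := h.hcart _ (h.pos hβ) _ (h.pos h.hθ)
  have hpe : (p : ℝ) * ⟪β, β⟫ = 2 * q := by
    rw [← hp, pairv_mul _ (by linarith), real_inner_comm]
  by_cases hp2 : 2 ≤ p
  · have hp2' : (2 : ℝ) ≤ p := by exact_mod_cast hp2
    have hqN : ⟪β, β⟫ ≤ q := by nlinarith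
    have hcs := real_inner_mul_inner_self_le β θ
    rw [h.hθ2, ← hqd] at hcs
    have hN2 : ⟪β, β⟫ = 2 := by nlinarith
    have hq2 : q = 2 := by nlinarith
    have : ⟪θ - β, θ - β⟫ = 0 := by
      rw [inner_sub_left, inner_sub_right, inner_sub_right, h.hθ2, hN2, real_inner_comm, ← hqd, hq2]
      norm_num
    have h0 : θ - β = 0 := inner_self_eq_zero.1 this
    rw [hN2]
    simp [h0, InC.zero]
  · have hp1 : (p : ℝ) ≤ 1 := by
      have : p ≤ 1 := by omega
      exact_mod_cast this
    have hle : 2 * q ≤ ⟪β, β⟫ := by nlinarith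
    have h1 := hpos.smul (inv_nonneg.2 hq0.le)
    have h2 := (h.posC hβ).smul (t := 1 / q - 2 / ⟪β, β⟫) (by
      rw [sub_nonneg, div_le_div_iff₀ (by linarith) hq0]; linarith)
    have h3 := h1.add h2
    have he : q⁻¹ • (q • θ - β) + (1 / q - 2 / ⟪β, β⟫) • β = θ - (2 / ⟪β, β⟫) • β := by
      rw [smul_sub, smul_smul, inv_mul_cancel₀ hq0.ne', sub_smul, one_div, one_smul]
      abel
    rwa [he] at h3

lemma RS.theta_ge (h : RS R Rplus simple θ) {β : V n} (hβ : β ∈ Rplus) :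
    InC simple (θ - (2 / ⟪β, β⟫) • β) := by
  obtain ⟨ρ, hρ⟩ := h.exists_rho
  obtain ⟨γ, ⟨hγ, hn, hC⟩, hmax⟩ := Set.exists_max_image
    {γ | γ ∈ R ∧ ⟪γ, γ⟫ = ⟪β, β⟫ ∧ InC simple (γ - β)} (fun a => ⟪a, ρ⟫)
    (h.hfin.subset fun a ha => ha.1) ⟨β, h.pos hβ, rfl, by simpa using InC.zero⟩
  have hβρ := h.ht_pos hρ hβ
  have hγp : γ ∈ Rplus := by
    rcases h.cases hγ with hh | hh
    · exact hh
    · have h1 := h.ht_pos hρ hh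
      have h2 := hC.ht hρ
      rw [inner_neg_left] at h1
      rw [inner_sub_left] at h2
      linarith
  have hdom : ∀ i, 0 ≤ ⟪γ, simple i⟫ := by
    intro i
    by_contra hlt
    push Not at hlt
    have hii := h.npos (h.pos (h.hsimple i))
    have hp : pairv γ (simple i) < 0 := by
      unfold pairv; exact div_neg_of_neg_of_pos (by linarith) hii
    have := hmax (γ - pairv γ (simple i) • simple i) ⟨h.hrefl _ (h.pos (h.hsimple i)) _ hγ, by
      rw [refl_norm γ hii, hn], by
      have := hC.add ((InC.simple (simple := simple) i).smul (t := - pairv γ (simple i))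
        (by linarith))
      convert this using 1
      rw [neg_smul]; abel⟩
    simp only [inner_sub_left, real_inner_smul_left, hρ] at this
    linarith
  have h1 := h.theta_ge_dom hγp hdom
  rw [hn] at h1
  have hN := h.npos (h.pos hβ)
  have h2 := h1.add (hC.smul (t := 2 / ⟪β, β⟫) (by positivity))
  convert h2 using 1
  rw [smul_sub]; abel

lemma RS.weyl_iff (h : RS R Rplus simple θ) {g : V n ≃ₗᵢ[ℝ] V n} (hg : g ∈ Weyl R) :
    ∀ α, g α ∈ R ↔ α ∈ R := by
  unfold Weyl at hg
  induction hg using Subgroup.closure_induction with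
  | mem g hg =>
    obtain ⟨β, hβ, hg⟩ := hg
    intro α
    constructor
    · intro hα
      have := h.hrefl _ hβ _ hα
      rw [hg α, refl_refl _ (h.npos hβ)] at this
      exact this
    · intro hα
      rw [hg]; exact h.hrefl _ hβ _ hα
  | one => intro α; rfl
  | mul g k _ _ h1 h2 => intro α; rw [← h2 α, ← h1 (k α)]; rfl
  | inv g _ h1 =>
    intro α
    rw [← h1 (g⁻¹ α)]
    have : g (g⁻¹ α) = α := g.apply_symm_apply α
    rw [this]

lemma RS.weyl_finite (h : RS R Rplus simple θ) : (Weyl R : Set (V n ≃ₗᵢ[ℝ] V n)).Finite := by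
  have hf : (Set.pi Set.univ (fun _ : Fin n => R)).Finite := Set.Finite.pi' (fun _ => h.hfin) |>.subset
    (fun x hx i => hx i trivial)
  refine Set.Finite.of_finite_image (f := fun g : V n ≃ₗᵢ[ℝ] V n => fun i => g (simple i))
    (hf.subset ?_) ?_
  · rintro _ ⟨g, hg, rfl⟩ i -
    exact (h.weyl_iff hg _).2 (h.pos (h.hsimple i))
  · intro g _ k _ hgk
    ext1 x
    have : (g.toLinearEquiv : V n →ₗ[ℝ] V n) = (k.toLinearEquiv : V n →ₗ[ℝ] V n) := by
      refine h.basis.ext fun i => ?_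
      rw [h.basis_apply]
      exact congrFun hgk i
    exact LinearMap.congr_fun this x

lemma RS.exists_refl (α : V n) (hα : α ∈ R) :
    ∃ g ∈ Weyl R, ∀ z, g z = z - pairv z α • α := by
  have key : ∀ z, (ℝ ∙ α)ᗮ.reflection z = z - pairv z α • α := by
    intro z
    rw [Submodule.reflection_orthogonal_apply, Submodule.reflection_singleton_apply]
    have : pairv z α = 2 * (⟪α, z⟫ / ‖α‖ ^ 2) := by
      unfold pairv; rw [real_inner_self_eq_norm_sq, real_inner_comm]; ring
    rw [this, mul_smul, two_smul, two_smul]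
    simp
  exact ⟨_, Subgroup.subset_closure ⟨α, hα, key⟩, key⟩

lemma RS.exists_ub (h : RS R Rplus simple θ) (b : V n) : ∃ u ∈ Weyl R,
    (∀ α ∈ Rplus, ⟪u b, α⟫ ≤ 0) ∧ (∀ α ∈ Rplus, u α ∈ -Rplus → ⟪α, b⟫ ≠ 0) := by
  obtain ⟨ρ, hρ⟩ := h.exists_rho
  obtain ⟨u, hu, hmin⟩ := Set.exists_min_image (Weyl R : Set (V n ≃ₗᵢ[ℝ] V n))
    (fun u => toLex (⟪u b, ρ⟫, -⟪u ρ, ρ⟫)) h.weyl_finite ⟨1, Subgroup.one_mem _⟩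
  refine ⟨u, hu, fun α hα => ?_, fun α hα huα h0 => ?_⟩
  · by_contra hlt
    push Not at hlt
    have hN := h.npos (h.pos hα)
    have hp : 0 < pairv (u b) α := by unfold pairv; positivity
    obtain ⟨g, hg, hgz⟩ := RS.exists_refl α (h.pos hα)
    have := hmin (g * u) (Subgroup.mul_mem _ hg hu)
    have e : (g * u) b = u b - pairv (u b) α • α := hgz (u b)
    have hα' := h.ht_pos hρ hα
    rw [Prod.Lex.toLex_le_toLex] at this
    simp only [e, inner_sub_left, real_inner_smul_left] at this
    have hpp := mul_pos hp hα'
    rcases this with hh | hh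
    · linarith
    · linarith [hh.1]
  · have hN := h.npos (h.pos hα)
    obtain ⟨g, hg, hgz⟩ := RS.exists_refl α (h.pos hα)
    have := hmin (u * g) (Subgroup.mul_mem _ hu hg)
    have e : (u * g) b = u b := by
      change u (g b) = u b
      rw [hgz, pairv, real_inner_comm, h0]; simp
    have e2 : (u * g) ρ = u ρ - pairv ρ α • u α := by
      change u (g ρ) = _
      rw [hgz]; simp
    have h1 := h.ht_pos hρ (Set.mem_neg.1 huα)
    rw [inner_neg_left] at h1
    have hα' := h.ht_pos hρ hα
    have hp : 0 < pairv ρ α := by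
      unfold pairv; rw [real_inner_comm]; positivity
    rw [Prod.Lex.toLex_le_toLex] at this
    simp only [e, e2, inner_sub_left, real_inner_smul_left] at this
    rcases this with hh | hh
    · linarith
    · have := hh.2
      nlinarith

/-- the membership condition -/
def Good (R Rplus : Set (V n)) (θ : V n) (e : ℕ) (b : V n) : Prop :=
  ∃ u : V n ≃ₗᵢ[ℝ] V n, u ∈ Weyl R ∧
            (∀ α ∈ Rplus, ⟪u b, α⟫ ≤ 0) ∧
            (∀ α ∈ Rplus, u α ∈ -Rplus → ⟪α, b⟫ ≠ 0) ∧
            (-⟪u b, θ⟫ < (e : ℝ) ∨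
              (-⟪u b, θ⟫ = (e : ℝ) ∧ u.symm θ ∈ -Rplus))

lemma RS.good_bounds (h : RS R Rplus simple θ) {e : ℕ} (he : 0 < e) {b : V n}
    (hb : Good R Rplus θ e b) {α : V n} (hα : α ∈ Rplus) :
    -(e : ℝ) < pairv b α ∧ pairv b α ≤ e := by
  obtain ⟨ρ, hρ⟩ := h.exists_rho
  obtain ⟨u, hu, hanti, hshortest, hcase⟩ := hb
  have he' : (0 : ℝ) < e := by exact_mod_cast he
  have hle : -⟪u b, θ⟫ ≤ e := by
    rcases hcase with hh | hh
    · exact hh.le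
    · exact hh.1.le
  have hpair : pairv b α = pairv (u b) (u α) := by
    simp [pairv, LinearIsometryEquiv.inner_map_map]
  have key : ∀ γ ∈ Rplus, ⟪u b, θ⟫ ≤ pairv (u b) γ ∧ pairv (u b) γ ≤ 0 := by
    intro γ hγ
    have hN := h.npos (h.pos hγ)
    constructor
    · obtain ⟨c, hc, ec⟩ := h.theta_ge hγ
      have : ⟪u b, θ - (2 / ⟪γ, γ⟫) • γ⟫ ≤ 0 := by
        rw [ec, inner_sum]
        refine Finset.sum_nonpos fun i _ => ?_
        rw [real_inner_smul_right]
        exact mul_nonpos_of_nonneg_of_nonpos (hc i) (hanti _ (h.hsimple i))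
      rw [inner_sub_right, real_inner_smul_right] at this
      have e2 : pairv (u b) γ = 2 / ⟪γ, γ⟫ * ⟪u b, γ⟫ := by unfold pairv; ring
      linarith
    · unfold pairv
      exact div_nonpos_of_nonpos_of_nonneg (by linarith [hanti γ hγ]) hN.le
  rcases h.cases ((h.weyl_iff hu α).2 (h.pos hα)) with hβ | hβ
  · obtain ⟨k1, k2⟩ := key _ hβ
    rw [hpair]
    refine ⟨?_, by linarith⟩
    by_contra hlt
    push Not at hlt
    rcases hcase with hh | ⟨hh, hneg⟩
    · linarith
    · have hN := h.npos (h.pos hβ)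
      obtain ⟨c, hc, ec⟩ := h.theta_ge hβ
      have hz : ⟪u b, θ - (2 / ⟪u α, u α⟫) • u α⟫ = 0 := by
        rw [inner_sub_right, real_inner_smul_right]
        have e2 : pairv (u b) (u α) = 2 / ⟪u α, u α⟫ * ⟪u b, u α⟫ := by unfold pairv; ring
        linarith
      have hnn : ∀ i ∈ Finset.univ, c i * ⟪u b, simple i⟫ ≤ 0 := fun i _ =>
        mul_nonpos_of_nonneg_of_nonpos (hc i) (hanti _ (h.hsimple i))
      have hz' := hz
      rw [ec, inner_sum] at hz'
      simp only [real_inner_smul_right] at hz'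
      have hz2 := (Finset.sum_eq_zero_iff_of_nonpos hnn).1 hz'
      have ht : 0 ≤ ⟪u.symm (θ - (2 / ⟪u α, u α⟫) • u α), ρ⟫ := by
        rw [ec, map_sum, sum_inner]
        refine Finset.sum_nonneg fun i hi => ?_
        rw [map_smul, real_inner_smul_left]
        rcases mul_eq_zero.1 (hz2 i hi) with h1 | h1
        · rw [h1, zero_mul]
        · refine mul_nonneg (hc i) ?_
          have hR' : u.symm (simple i) ∈ R := by
            rw [← h.weyl_iff hu]; simpa using h.pos (h.hsimple i)
          rcases h.cases hR' with hp | hp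
          · exact (h.ht_pos hρ hp).le
          · exfalso
            refine hshortest _ hp ?_ ?_
            · simpa using h.hsimple i
            · rw [← u.inner_map_map]
              rw [real_inner_comm]; simp [h1]
      rw [map_sub, map_smul, u.symm_apply_apply, inner_sub_left, real_inner_smul_left] at ht
      have h1 := h.ht_pos hρ (Set.mem_neg.1 hneg)
      rw [inner_neg_left] at h1
      have h2 : 0 < 2 / ⟪u α, u α⟫ * ⟪α, ρ⟫ := mul_pos (by positivity) (h.ht_pos hρ hα)
      linarith
  · obtain ⟨k1, k2⟩ := key _ hβ
    rw [pairv_neg] at k1 k2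
    rw [hpair]
    constructor <;> linarith

lemma RS.pair_int (h : RS R Rplus simple θ) {q α : V n} (hq : InQ simple q) (hα : α ∈ R) :
    ∃ m : ℤ, pairv q α = m := by
  obtain ⟨l, rfl⟩ := hq
  choose m hm using fun i => h.hcart α hα (simple i) (h.pos (h.hsimple i))
  refine ⟨∑ i, l i * m i, ?_⟩
  push_cast
  simp only [← hm]
  simp only [pairv, sum_inner, real_inner_smul_left, Finset.mul_sum, Finset.sum_div]
  exact Finset.sum_congr rfl fun i _ => by ring

lemma RS.zero_of_small (h : RS R Rplus simple θ) : ∀ (N : ℕ) (l : Fin n → ℤ),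
    (∑ i, (l i).natAbs ≤ N) →
    (∀ α ∈ R, |pairv (∑ i, (l i : ℝ) • simple i) α| ≤ 1) → ∑ i, (l i : ℝ) • simple i = 0 := by
  classical
  intro N
  induction N with
  | zero =>
    intro l hl _
    have := Finset.sum_eq_zero_iff.1 (Nat.le_zero.1 hl)
    refine Finset.sum_eq_zero fun i hi => ?_
    have : l i = 0 := Int.natAbs_eq_zero.1 (this i hi)
    simp [this]
  | succ N ih =>
    intro l hl hsmall
    by_contra hne
    set q := ∑ i, (l i : ℝ) • simple i with hq
    have : ∃ i, 0 < (l i : ℝ) * ⟪q, simple i⟫ := by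
      by_contra hcon
      push Not at hcon
      have h1 : 0 < ⟪q, q⟫ := real_inner_self_pos.2 hne
      nth_rewrite 2 [hq] at h1
      rw [inner_sum] at h1
      have : ∑ i, ⟪q, (l i : ℝ) • simple i⟫ ≤ 0 := Finset.sum_nonpos fun i _ => by
        rw [real_inner_smul_right]; exact hcon i
      linarith
    obtain ⟨i, hi⟩ := this
    have hiR := h.pos (h.hsimple i)
    have hii := h.npos hiR
    obtain ⟨m, hm⟩ := h.pair_int ⟨l, hq⟩ hiR
    have hm1 : |m| ≤ 1 := by
      have := hsmall _ hiR
      rw [hm] at this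
      exact_mod_cast this
    have hlm : 0 < l i * m := by
      have : 0 < (l i : ℝ) * m := by
        rw [← hm]; unfold pairv
        have : (l i : ℝ) * (2 * ⟪q, simple i⟫ / ⟪simple i, simple i⟫)
          = 2 * ((l i : ℝ) * ⟪q, simple i⟫) / ⟪simple i, simple i⟫ := by ring
        rw [this]; positivity
      exact_mod_cast this
    have hred : (l i - m).natAbs + 1 = (l i).natAbs := by
      have hmc : m = 1 ∨ m = -1 := by
        have hm0 : m ≠ 0 := by rintro rfl; simp at hlm
        rw [abs_le] at hm1
        omega
      rcases hmc with rfl | rfl <;> omega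
    let l' : Fin n → ℤ := fun k => l k - if k = i then m else 0
    have hl' : ∑ k, (l' k : ℝ) • simple k = q - pairv q (simple i) • simple i := by
      rw [hm]; simp [l', sub_smul, Finset.sum_sub_distrib, hq]
    obtain ⟨g, hg, hgz⟩ := RS.exists_refl (simple i) hiR
    have hz := ih l' (by
      have e1 := Finset.add_sum_erase Finset.univ (fun k => (l' k).natAbs) (Finset.mem_univ i)
      have e2 := Finset.add_sum_erase Finset.univ (fun k => (l k).natAbs) (Finset.mem_univ i)
      have e3 : ∑ k ∈ Finset.univ.erase i, (l' k).natAbs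
          = ∑ k ∈ Finset.univ.erase i, (l k).natAbs := by
        refine Finset.sum_congr rfl fun k hk => ?_
        simp [l', Finset.ne_of_mem_erase hk]
      have e4 : l' i = l i - m := by simp [l']
      simp only [e4] at e1
      omega) (by
      intro α hα
      rw [hl', ← hgz]
      have : pairv (g q) α = pairv q (g.symm α) := by
        unfold pairv
        rw [LinearIsometryEquiv.inner_map_map]
        have e5 : ⟪g q, α⟫ = ⟪q, g.symm α⟫ := by
          rw [← g.inner_map_map q]; simp
        rw [e5]
      rw [this]
      apply hsmall
      rw [← h.weyl_iff hg]; simpa using hα)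
    rw [hl', ← hgz] at hz
    exact hne (by simpa using hz)

lemma RS.inj (h : RS R Rplus simple θ) {e : ℕ} (he : 0 < e) {b b' a : V n}
    (hb : Good R Rplus θ e b) (hb' : Good R Rplus θ e b') (ha : InQ simple a)
    (hba : b' = b + (e : ℝ) • a) : a = 0 := by
  have he' : (0 : ℝ) < e := by exact_mod_cast he
  have key : ∀ α ∈ Rplus, |pairv a α| ≤ 1 := by
    intro α hα
    obtain ⟨h1, h2⟩ := h.good_bounds he hb hα
    obtain ⟨h3, h4⟩ := h.good_bounds he hb' hα
    rw [hba, pairv_add, pairv_smul] at h3 h4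
    obtain ⟨m, hm⟩ := h.pair_int ha (h.pos hα)
    rw [hm] at h3 h4 ⊢
    have a1 : (m : ℝ) < 2 := by nlinarith
    have a2 : (-2 : ℝ) < m := by nlinarith
    have a1' : m < 2 := by exact_mod_cast a1
    have a2' : -2 < m := by exact_mod_cast a2
    have : |m| ≤ 1 := by rw [abs_le]; omega
    exact_mod_cast this
  obtain ⟨l, rfl⟩ := ha
  refine h.zero_of_small _ l le_rfl fun α hα => ?_
  rcases h.cases hα with hp | hp
  · exact key _ hp
  · have := key _ hp
    rwa [pairv_neg, abs_neg] at this

lemma RS.InQ_mem (h : RS R Rplus simple θ) {v : V n} (hv : InQ simple v) :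
    v ∈ Submodule.span ℤ (Set.range h.basis) := by
  obtain ⟨l, rfl⟩ := hv
  refine Submodule.sum_mem _ fun i _ => ?_
  rw [Int.cast_smul_eq_zsmul]
  exact Submodule.smul_mem _ _ (Submodule.subset_span ⟨i, h.basis_apply i⟩)

lemma RS.surj (h : RS R Rplus simple θ) {e : ℕ} (he : 0 < e) {c : V n}
    (hc : InQ simple c) : ∃ a, InQ simple a ∧ Good R Rplus θ e (c + (e : ℝ) • a) := by
  obtain ⟨ρ, hρ⟩ := h.exists_rho
  have hQ : ∀ a, InQ simple a → InQ simple ((e : ℝ) • a) := fun a ha => by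
    simpa using ha.zsmul e
  have hfin : {b | (∃ a, InQ simple a ∧ b = c + (e : ℝ) • a) ∧ ‖b‖ ≤ ‖c‖}.Finite := by
    refine (ZSpan.setFinite_inter h.basis
      (Metric.isBounded_closedBall (x := (0 : V n)) (r := ‖c‖))).subset ?_
    rintro b ⟨⟨a, ha, rfl⟩, hb⟩
    exact ⟨by simpa using hb, h.InQ_mem (hc.add (hQ a ha))⟩
  obtain ⟨b, ⟨⟨a, ha, hba⟩, hbc⟩, hmin⟩ := Set.exists_min_image _
    (fun b => toLex (⟪b, b⟫, -⟪b, ρ⟫)) hfin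
    ⟨c, ⟨0, ⟨fun _ => 0, by simp⟩, by simp⟩, le_rfl⟩
  have hmin' : ∀ γ ∈ R, toLex (⟪b, b⟫, -⟪b, ρ⟫) ≤
      toLex (⟪b + (e : ℝ) • γ, b + (e : ℝ) • γ⟫, -⟪b + (e : ℝ) • γ, ρ⟫) := by
    intro γ hγ
    by_cases hn : ‖b + (e : ℝ) • γ‖ ≤ ‖c‖
    · exact hmin _ ⟨⟨a + γ, ha.add (h.rootQ hγ), by rw [hba, smul_add, add_assoc]⟩, hn⟩
    · rw [Prod.Lex.toLex_le_toLex]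
      left
      simp only [real_inner_self_eq_norm_sq]
      push Not at hn
      have := norm_nonneg b
      nlinarith
  refine ⟨a, ha, ?_⟩
  rw [← hba]
  obtain ⟨u, hu, hanti, hsh⟩ := h.exists_ub b
  refine ⟨u, hu, hanti, hsh, ?_⟩
  have hγR : u.symm θ ∈ R := by
    rw [← h.weyl_iff hu]; simpa using h.pos h.hθ
  have hγ2 : ⟪u.symm θ, u.symm θ⟫ = 2 := by
    rw [LinearIsometryEquiv.inner_map_map, h.hθ2]
  have hbγ : ⟪b, u.symm θ⟫ = ⟪u b, θ⟫ := by
    rw [← u.inner_map_map]; simp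
  have hm := hmin' _ hγR
  set γ := u.symm θ
  have en : ⟪b + (e : ℝ) • γ, b + (e : ℝ) • γ⟫ = ⟪b, b⟫ + 2 * e * (⟪u b, θ⟫ + e) := by
    rw [inner_add_left, inner_add_right, inner_add_right, real_inner_smul_left,
      real_inner_smul_left, real_inner_smul_right, real_inner_smul_right, hγ2,
      real_inner_comm b γ, hbγ]
    ring
  rw [Prod.Lex.toLex_le_toLex] at hm
  simp only [en, inner_add_left, real_inner_smul_left] at hm
  have he' : (0 : ℝ) < e := by exact_mod_cast he
  rcases hm with hm | ⟨hm1, hm2⟩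
  · left
    have : 0 < 2 * (e : ℝ) * (⟪u b, θ⟫ + e) := by linarith
    have := pos_of_mul_pos_right this (by positivity)
    linarith
  · right
    have h0 : 2 * (e : ℝ) * (⟪u b, θ⟫ + e) = 0 := by linarith
    have h1 : ⟪u b, θ⟫ + e = 0 := (mul_eq_zero.1 h0).resolve_left (by positivity)
    refine ⟨by linarith, ?_⟩
    rcases h.cases hγR with hp | hp
    · have := mul_pos he' (h.ht_pos hρ hp)
      linarith
    · simpa using hp

end CAP

/-- For a reduced irreducible root system `R` with highest short root `θ` and any
positive integer `e`, the set of weights `b` in the root lattice `Q` with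
`b = 0`, or `−(b₋,θ) < e`, or `−(b₋,θ) = e` and `u_b⁻¹(θ) ∈ R₋`,
has exactly `eⁿ` elements. -/
theorem count_alcove_points (n : ℕ) (R Rplus : Set (V n))
    (simple : Fin n → V n)
    (hfin : R.Finite) (hR : R = Rplus ∪ (-Rplus)) (hdisj : Disjoint Rplus (-Rplus))
    (h0 : (0 : V n) ∉ R)
    (hsimple : ∀ i, simple i ∈ Rplus)
    (hindep : LinearIndependent ℝ simple)
    (hpos_sum : ∀ α ∈ Rplus, ∃ c : Fin n → ℕ, α = ∑ i, (c i : ℝ) • simple i)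
    (hrefl : ∀ α ∈ R, ∀ β ∈ R, β - pairv β α • α ∈ R)
    (hcart : ∀ α ∈ R, ∀ β ∈ R, ∃ m : ℤ, pairv β α = m)
    (hirr : ∀ S T : Set (V n), S ∪ T = R → (∀ a ∈ S, ∀ b ∈ T, ⟪a, b⟫ = 0) →
      S = ∅ ∨ T = ∅)
    (hshort : ∀ α ∈ R, 2 ≤ ⟪α, α⟫)
    -- `θ`: the highest short root
    (θ : V n) (hθ : θ ∈ Rplus) (hθ2 : ⟪θ, θ⟫ = 2)
    (hθdom : ∀ α ∈ Rplus, 0 ≤ ⟪θ, α⟫)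
    (e : ℕ) (he : 0 < e) :
    Set.ncard
      {b : V n |
        (∃ l : Fin n → ℤ, b = ∑ i, (l i : ℝ) • simple i) ∧
        (b = 0 ∨
          ∃ u : V n ≃ₗᵢ[ℝ] V n, u ∈ Weyl R ∧
            (∀ α ∈ Rplus, ⟪u b, α⟫ ≤ 0) ∧
            (∀ α ∈ Rplus, u α ∈ -Rplus → ⟪α, b⟫ ≠ 0) ∧
            (-⟪u b, θ⟫ < (e : ℝ) ∨
              (-⟪u b, θ⟫ = (e : ℝ) ∧ u.symm θ ∈ -Rplus)))} = e ^ n := by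
  have h : CAP.RS R Rplus simple θ := ⟨hfin, hR, h0, hsimple, hindep, hpos_sum, hrefl, hcart,
    hirr, hshort, hθ, hθ2, hθdom⟩
  have : NeZero e := ⟨he.ne'⟩
  have hgood0 : CAP.Good R Rplus θ e 0 := by
    refine ⟨1, Subgroup.one_mem _, by simp, ?_, Or.inl (by simpa using he)⟩
    intro α hα hα'
    exact absurd hα' (Set.disjoint_left.1 hdisj hα)
  have hset : {b : V n |
        (∃ l : Fin n → ℤ, b = ∑ i, (l i : ℝ) • simple i) ∧
        (b = 0 ∨
          ∃ u : V n ≃ₗᵢ[ℝ] V n, u ∈ Weyl R ∧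
            (∀ α ∈ Rplus, ⟪u b, α⟫ ≤ 0) ∧
            (∀ α ∈ Rplus, u α ∈ -Rplus → ⟪α, b⟫ ≠ 0) ∧
            (-⟪u b, θ⟫ < (e : ℝ) ∨
              (-⟪u b, θ⟫ = (e : ℝ) ∧ u.symm θ ∈ -Rplus)))}
      = {b : V n | CAP.InQ simple b ∧ CAP.Good R Rplus θ e b} := by
    ext b
    constructor
    · rintro ⟨hQ, rfl | hb⟩
      · exact ⟨hQ, hgood0⟩
      · exact ⟨hQ, hb⟩
    · rintro ⟨hQ, hb⟩
      exact ⟨hQ, Or.inr hb⟩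
  rw [hset]
  let f : V n → (Fin n → ZMod e) := fun b i => ((⌊h.basis.repr b i⌋ : ℤ) : ZMod e)
  have hf : ∀ l : Fin n → ℤ, f (∑ i, (l i : ℝ) • simple i) = fun i => (l i : ZMod e) := by
    intro l
    funext i
    have : h.basis.repr (∑ i, (l i : ℝ) • simple i) i = l i := by
      simp only [← h.basis_apply]
      rw [h.basis.repr_sum_self]
    simp only [f, this, Int.floor_intCast]
  have hbij : Set.BijOn f {b : V n | CAP.InQ simple b ∧ CAP.Good R Rplus θ e b} Set.univ := by
    refine ⟨fun _ _ => trivial, ?_, ?_⟩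
    · rintro b ⟨⟨l, rfl⟩, hb⟩ b' ⟨⟨l', rfl⟩, hb'⟩ hff
      rw [hf, hf] at hff
      have hdvd : ∀ i, (e : ℤ) ∣ l' i - l i := fun i =>
        (ZMod.intCast_eq_intCast_iff_dvd_sub _ _ _).1 (congrFun hff i)
      choose k hk using hdvd
      have heq : ∑ i, (l' i : ℝ) • simple i = ∑ i, (l i : ℝ) • simple i
          + (e : ℝ) • ∑ i, (k i : ℝ) • simple i := by
        rw [Finset.smul_sum, ← Finset.sum_add_distrib]
        refine Finset.sum_congr rfl fun i _ => ?_
        have : l' i = l i + e * k i := by linarith [hk i]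
        rw [this]; push_cast; rw [add_smul, mul_smul]
      have := h.inj he hb hb' ⟨k, rfl⟩ heq
      rw [heq, this]; simp
    · intro m _
      obtain ⟨a, ⟨k, hk⟩, hg⟩ := h.surj (e := e) he
        (c := ∑ i, (((m i).val : ℤ) : ℝ) • simple i) ⟨fun i => ((m i).val : ℤ), rfl⟩
      have heq : ∑ i, (((m i).val : ℤ) : ℝ) • simple i + (e : ℝ) • a
          = ∑ i, ((((m i).val : ℤ) + e * k i : ℤ) : ℝ) • simple i := by
        rw [hk, Finset.smul_sum, ← Finset.sum_add_distrib]
        refine Finset.sum_congr rfl fun i _ => ?_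
        push_cast; rw [add_smul, mul_smul]
      refine ⟨_, ⟨⟨_, heq⟩, hg⟩, ?_⟩
      rw [heq, hf]
      funext i
      simp
  rw [hbij.ncard_eq, Set.ncard_univ, Nat.card_eq_fintype_card]
  simp [ZMod.card]
end
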